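/- Let p be a prime, let b ∈ ℕ and g ∈ ℤ⁺, and let P, Q, X, Y be integers with P > Q > 0, X ≥ 3b, and Y ≥ max{b, p^{4P}}. Suppose there exist integers h, k, l, w, x, y with l·x ≠ 0 such that, with L, U, V, W, K, A, B, C, D, E, F, G, H, I defined from these data as in the context, the following hold: D·F·I ∈ □, (U^{2P}V² − 4)K² + 4 ∈ □, pA − p² − 1 divides (p² − 1)WC − p(W² − 1), and 4(C − KL)² < K². Then b ∈ p↑ and Y divides the binomial coefficient C(PX, QX). -/

import Mathlib

open Polynomial in
/-- The Lucas sequence `u_n(A, 1)`, indexed by the integers. -/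
noncomputable def lucasU (A n : ℤ) : ℤ := (Chebyshev.S ℤ (n - 1)).eval A

namespace lucasU

variable (A : ℤ)

theorem zero : lucasU A 0 = 0 := by simp [lucasU]

theorem one : lucasU A 1 = 1 := by simp [lucasU]

theorem add_two (n : ℤ) : lucasU A (n + 2) = A * lucasU A (n + 1) - lucasU A n := by
  have h := congrArg (Polynomial.eval A) (Polynomial.Chebyshev.S_add_two ℤ (n - 1))
  simp only [Polynomial.eval_sub, Polynomial.eval_mul, Polynomial.eval_X] at h
  simp only [lucasU]
  rw [add_sub_right_comm, h, sub_add_cancel, add_sub_cancel_right]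

theorem neg (n : ℤ) : lucasU A (-n) = -lucasU A n := by
  simp [lucasU, Polynomial.Chebyshev.S_neg_sub_one]

theorem at_two (n : ℤ) : lucasU 2 n = n := by
  simp [lucasU]

theorem modEq {a b m : ℤ} (h : m ∣ a - b) (n : ℤ) : m ∣ lucasU a n - lucasU b n :=
  h.trans (Polynomial.sub_dvd_eval_sub a b _)

theorem modEq_self (n : ℤ) : A - 2 ∣ lucasU A n - n := by
  simpa only [at_two] using modEq (dvd_refl (A - 2)) n

/-- Every solution of the Lucas recurrence is determined by its first two values. -/
theorem eq_of_recurrence (f : ℤ → ℤ) (hf : ∀ n, f (n + 2) = A * f (n + 1) - f n) (n : ℤ) :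
    f n = f 1 * lucasU A n + f 0 * (lucasU A (n + 1) - A * lucasU A n) := by
  induction n using Polynomial.Chebyshev.induct with
  | zero => simp [zero, one]
  | one =>
    have := add_two A 0
    simp only [zero_add, one, zero] at this
    simp [one, this]
  | add_two n h1 h2 =>
    have e1 := add_two A n
    have e2 := add_two A (n + 1)
    have e3 := hf n
    rw [e3, h1, h2]
    ring_nf at *
    rw [e2, e1]; ring
  | neg_add_one n h1 h2 =>
    have e1 := add_two A (-n - 1)
    have e3 := hf (-n - 1)
    have e2 := add_two A (-n)
    ring_nf at *
    linear_combination e3 + A * h1 - h2 - f 1 * e1 - f 0 * e2 + f 0 * A * e1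

theorem add (m n : ℤ) : lucasU A (m + n) =
    lucasU A m * lucasU A (n + 1) + lucasU A (m + 1) * lucasU A n
      - A * lucasU A m * lucasU A n := by
  have h := eq_of_recurrence A (fun k => lucasU A (m + k)) (fun k => by
    simp only [← add_assoc]; exact add_two A _) n
  simp only [add_zero] at h
  linear_combination h

theorem norm_eq_one (n : ℤ) :
    lucasU A (n + 1) ^ 2 - A * lucasU A (n + 1) * lucasU A n + lucasU A n ^ 2 = 1 := by
  have h := congrArg (Polynomial.eval A) (Polynomial.Chebyshev.S_sq_add_S_sq ℤ (n - 1))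
  simp at h
  simp only [lucasU, add_sub_cancel_right]
  linear_combination h

theorem isCoprime_succ (n : ℤ) : IsCoprime (lucasU A n) (lucasU A (n + 1)) :=
  ⟨lucasU A n - A * lucasU A (n + 1), lucasU A (n + 1), by linear_combination norm_eq_one A n⟩

theorem exists_of_norm_eq_one (a c : ℤ) (h : a ^ 2 - A * a * c + c ^ 2 = 1) :
    ∃ s : ℤ, (a = lucasU A (s + 1) ∧ c = lucasU A s) ∨
      (a = -lucasU A (s + 1) ∧ c = -lucasU A s) := by
  induction hk : c.natAbs using Nat.strong_induction_on generalizing a c with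
  | _ k ih =>
  subst hk
  by_cases hc : c = 0
  · subst hc
    have : a = 1 ∨ a = -1 := by
      have : a ^ 2 = 1 := by linear_combination h
      exact by simpa using this
    refine ⟨0, ?_⟩
    simpa [zero, one] using this
  · by_cases ha : |a| < |c|
    · obtain ⟨s, hs⟩ := ih a.natAbs (by zify; exact ha) c a (by linear_combination h) rfl
      refine ⟨-s - 1, ?_⟩
      have e1 : lucasU A (-s - 1 + 1) = -lucasU A s := by rw [← neg]; congr 1; ring
      have e2 : lucasU A (-s - 1) = -lucasU A (s + 1) := by rw [← neg]; congr 1; ring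
      rw [e1, e2]
      omega
    · have h' : |A * c - a| < |c| := by
        by_contra hcon
        push Not at ha hcon
        have h1 : |c| * |c| ≤ |a| * |A * c - a| := by gcongr
        have h2 : a * (A * c - a) = c * c - 1 := by linear_combination -h
        have h3 : 0 < c * c := mul_self_pos.mpr hc
        rw [← abs_mul, ← abs_mul, h2, abs_of_pos h3, abs_of_nonneg (by omega)] at h1
        omega
      obtain ⟨s, hs⟩ := ih (A * c - a).natAbs (by zify; exact h') c (A * c - a)
        (by linear_combination h) rfl
      refine ⟨s + 1, ?_⟩
      have e := add_two A s
      rw [add_assoc, one_add_one_eq_two, e]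
      rcases hs with ⟨h1, h2⟩ | ⟨h1, h2⟩
      · left; exact ⟨by rw [← h1, ← h2]; ring, h1⟩
      · right; exact ⟨by linear_combination A * h1 - h2, h1⟩

theorem discr (n : ℤ) : (A ^ 2 - 4) * lucasU A n ^ 2 + 4 =
    (2 * lucasU A (n + 1) - A * lucasU A n) ^ 2 := by
  linear_combination -4 * norm_eq_one A n

theorem exists_of_isSquare {A c : ℤ} (h : ∃ m : ℤ, (A ^ 2 - 4) * c ^ 2 + 4 = m ^ 2) :
    ∃ s : ℤ, c = lucasU A s := by
  obtain ⟨m, hm⟩ := h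
  have hpar : Even (m + A * c) := by
    have : Even (m ^ 2 - (A * c) ^ 2) := ⟨2 - 2 * c ^ 2, by linear_combination -hm⟩
    simpa [Int.even_sub, Int.even_add, Int.even_pow] using this
  obtain ⟨a, ha⟩ := hpar
  have hn : a ^ 2 - A * a * c + c ^ 2 = 1 := by
    have : m = 2 * a - A * c := by linear_combination ha
    subst this
    linarith
  obtain ⟨s, ⟨-, h⟩ | ⟨-, h⟩⟩ := exists_of_norm_eq_one A a c hn
  · exact ⟨s, h⟩
  · exact ⟨-s, by rw [neg, h]⟩

theorem abs_natAbs (n : ℤ) : |lucasU A n.natAbs| = |lucasU A n| := by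
  rcases Int.natAbs_eq n with h | h
  · rw [← h]
  · conv_rhs => rw [h, neg, abs_neg]

variable {A}

theorem abs_step (hA : 2 ≤ |A|) (n : ℕ) :
    |lucasU A n| < |lucasU A (n + 1 : ℕ)| ∧
      (|A| - 1) * |lucasU A n| ≤ |lucasU A (n + 1 : ℕ)| := by
  induction n with
  | zero => simp [zero, one]
  | succ n ih =>
    have e := add_two A n
    have h1 : |A| * |lucasU A (n + 1 : ℕ)| ≤ |lucasU A (n + 1 + 1 : ℕ)| + |lucasU A n| := by
      rw [← abs_mul]
      have : A * lucasU A (n + 1 : ℕ) = lucasU A (n + 1 + 1 : ℕ) + lucasU A n := by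
        push_cast; rw [add_assoc, one_add_one_eq_two, e]; ring
      rw [this]; exact abs_add_le _ _
    have := abs_nonneg (lucasU A (n + 1 : ℕ))
    constructor <;> nlinarith [ih.1]

theorem abs_strictMono (hA : 2 ≤ |A|) : StrictMono fun n : ℕ => |lucasU A n| :=
  strictMono_nat_of_lt_succ fun n => (abs_step hA n).1

theorem abs_lt_abs (hA : 2 ≤ |A|) {m n : ℤ} (h : |m| < |n|) : |lucasU A m| < |lucasU A n| := by
  rw [← abs_natAbs A m, ← abs_natAbs A n]
  exact abs_strictMono hA (by zify; exact h)

theorem abs_le_abs (hA : 2 ≤ |A|) {m n : ℤ} (h : |m| ≤ |n|) : |lucasU A m| ≤ |lucasU A n| := by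
  rw [← abs_natAbs A m, ← abs_natAbs A n]
  exact (abs_strictMono hA).monotone (by zify; exact h)

theorem abs_self_le (hA : 2 ≤ |A|) (n : ℤ) : |n| ≤ |lucasU A n| := by
  rw [← abs_natAbs A n, Int.abs_eq_natAbs]
  generalize n.natAbs = k
  induction k with
  | zero => simp
  | succ k ih => have := (abs_step hA k).1; push_cast at *; omega

theorem pow_le_abs (hA : 2 ≤ |A|) (n : ℕ) : (|A| - 1) ^ n ≤ |lucasU A (n + 1 : ℕ)| := by
  induction n with
  | zero => simp [one]
  | succ n ih =>
    have := (abs_step hA (n + 1)).2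
    rw [pow_succ']
    exact (mul_le_mul_of_nonneg_left ih (by omega)).trans this

theorem eq_zero_iff (hA : 2 ≤ |A|) {n : ℤ} : lucasU A n = 0 ↔ n = 0 := by
  refine ⟨fun h => ?_, fun h => by rw [h, zero]⟩
  have := abs_self_le hA n
  rw [h, abs_zero] at this
  exact abs_nonpos_iff.mp this

theorem injective (hA : 2 ≤ |A|) : Function.Injective (lucasU A) := by
  intro m n h
  rcases lt_trichotomy |m| |n| with h' | h' | h'
  · exact absurd (congrArg abs h) (abs_lt_abs hA h').ne
  · rcases abs_eq_abs.mp h' with h' | h'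
    · exact h'
    · subst h'
      rw [neg] at h
      have : lucasU A n = 0 := by omega
      rw [eq_zero_iff hA] at this
      simp [this]
  · exact absurd (congrArg abs h) (abs_lt_abs hA h').ne'

theorem mul_modEq (s : ℤ) (k : ℕ) :
    lucasU A s ^ 2 ∣ lucasU A (s * (k + 1 : ℕ)) -
        (k + 1) * lucasU A s * lucasU A (s + 1) ^ k ∧
      lucasU A s ∣ lucasU A (s * (k + 1 : ℕ) + 1) - lucasU A (s + 1) ^ (k + 1) := by
  induction k with
  | zero => simp
  | succ k ih =>
    obtain ⟨⟨a, ha⟩, ⟨b, hb⟩⟩ := ih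
    have e1 : s * (k + 1 + 1 : ℕ) = s * (k + 1 : ℕ) + s := by push_cast; ring
    have e2 : s * (k + 1 : ℕ) + s + 1 = (s * (k + 1 : ℕ) + 1) + s := by ring
    have f1 := add A (s * (k + 1 : ℕ)) s
    have f2 := add A (s * (k + 1 : ℕ) + 1) s
    rw [e1, e2, f1, f2]
    generalize lucasU A (s * (k + 1 : ℕ)) = x at *
    generalize lucasU A (s * (k + 1 : ℕ) + 1) = y at *
    generalize lucasU A (s * (k + 1 : ℕ) + 1 + 1) = z at *
    generalize lucasU A (s + 1) = v at *
    generalize lucasU A s = u at *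
    have hx : x = (k + 1) * u * v ^ k + u ^ 2 * a := by linear_combination ha
    have hy : y = v ^ (k + 1) + u * b := by linear_combination hb
    constructor
    · refine ⟨a * v + b - A * ((k + 1) * v ^ k + u * a), ?_⟩
      rw [hx, hy]; push_cast; ring
    · refine ⟨b * v + z - A * y, ?_⟩
      rw [hy]; ring

theorem dvd_mul (s q : ℤ) : lucasU A s ∣ lucasU A (s * q) := by
  have key : ∀ k : ℕ, lucasU A s ∣ lucasU A (s * k) := by
    intro k
    cases k with
    | zero => simp [zero]
    | succ k =>
      have h := (mul_modEq (A := A) s k).1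
      exact (dvd_sub_left (((dvd_mul_left _ _).mul_right _))).mp
        ((dvd_pow_self _ two_ne_zero).trans h)
  rcases Int.natAbs_eq q with h | h <;> rw [h]
  · exact key _
  · rw [mul_neg, neg, dvd_neg]; exact key _

theorem dvd_of_dvd (hA : 2 ≤ |A|) {s n : ℤ} (hs : s ≠ 0) (h : lucasU A s ∣ lucasU A n) :
    s ∣ n := by
  have e := add A (s * (n / s)) (n % s)
  rw [Int.mul_ediv_add_emod] at e
  have h1 : lucasU A s ∣ lucasU A (s * (n / s)) := dvd_mul s _
  have h2 : IsCoprime (lucasU A s) (lucasU A (s * (n / s) + 1)) :=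
    (isCoprime_succ A (s * (n / s))).of_isCoprime_of_dvd_left h1
  have h3 : lucasU A s ∣ lucasU A (n % s) := by
    refine h2.dvd_of_dvd_mul_left ?_
    have : lucasU A (s * (n / s) + 1) * lucasU A (n % s) = lucasU A n -
        lucasU A (s * (n / s)) * (lucasU A (n % s + 1) - A * lucasU A (n % s)) := by
      linear_combination -e
    rw [this]
    exact dvd_sub h (h1.mul_right _)
  have h4 : lucasU A (n % s) = 0 := by
    refine Int.eq_zero_of_abs_lt_dvd ((abs_dvd _ _).mpr h3) (abs_lt_abs hA ?_)
    rw [abs_of_nonneg (Int.emod_nonneg n hs)]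
    exact Int.emod_lt_abs n hs
  exact Int.dvd_of_emod_eq_zero ((eq_zero_iff hA).mp h4)

/-- The first step-down lemma. -/
theorem dvd_of_sq_dvd (hA : 2 ≤ |A|) {s n : ℤ} (hs : s ≠ 0)
    (h : lucasU A s ^ 2 ∣ lucasU A n) : lucasU A s ∣ n := by
  have hs' : lucasU A s ≠ 0 := (eq_zero_iff hA).not.mpr hs
  have key : ∀ k : ℕ, lucasU A s ^ 2 ∣ lucasU A (s * k) → lucasU A s ∣ k := by
    intro k hk
    cases k with
    | zero => simp
    | succ k =>
      have h1 := (dvd_sub_right hk).mp (mul_modEq (A := A) s k).1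
      have h2 : lucasU A s ∣ (k + 1) * lucasU A (s + 1) ^ k := by
        rw [← mul_dvd_mul_iff_left hs']
        convert h1 using 1 <;> ring
      push_cast
      exact ((isCoprime_succ A s).pow_right).dvd_of_dvd_mul_right h2
  obtain ⟨q, rfl⟩ := dvd_of_dvd hA hs ((dvd_pow_self _ two_ne_zero).trans h)
  refine Dvd.dvd.mul_left ?_ s
  rw [← Int.dvd_natAbs]
  apply key
  rcases Int.natAbs_eq q with h' | h'
  · rwa [← h']
  · have : s * (q.natAbs : ℤ) = -(s * q) := by rw [← mul_neg]; congr 1; omega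
    rwa [this, neg, dvd_neg]

variable (A) in
/-- The companion sequence `v_n = 2 u_{n+1} - A u_n` annihilates `u_{m+2n} + u_m`. -/
theorem companion_dvd (m n : ℤ) :
    2 * lucasU A (n + 1) - A * lucasU A n ∣ lucasU A (m + 2 * n) + lucasU A m := by
  have e1 := add A (m + n) n
  have e2 := add A (m + n) (-n)
  have e3 : lucasU A (-n + 1) = lucasU A (n + 1) - A * lucasU A n := by
    have h1 : -n + 1 = -(n - 1) := by ring
    have h2 := add_two A (n - 1)
    rw [sub_add_cancel, show n - 1 + 2 = n + 1 by ring] at h2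
    rw [h1, neg, h2]
    ring
  rw [neg, e3, add_neg_cancel_right] at e2
  refine ⟨lucasU A (m + n), ?_⟩
  rw [show m + 2 * n = m + n + n by ring]
  linear_combination e1 + e2

theorem dvd_sub_or_dvd_add {f n : ℤ} (hf : f ∣ 2 * lucasU A (n + 1) - A * lucasU A n) (m q : ℤ) :
    f ∣ lucasU A (m + 2 * n * q) - lucasU A m ∨ f ∣ lucasU A (m + 2 * n * q) + lucasU A m := by
  have key : ∀ (k : ℕ) (m : ℤ), f ∣ lucasU A (m + 2 * n * k) - lucasU A m ∨
      f ∣ lucasU A (m + 2 * n * k) + lucasU A m := by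
    intro k m
    induction k with
    | zero => simp
    | succ k ih =>
      have h := hf.trans (companion_dvd A (m + 2 * n * k) n)
      rw [show m + 2 * n * (k + 1 : ℕ) = m + 2 * n * k + 2 * n by push_cast; ring]
      rcases ih with ih | ih
      · right; exact (dvd_sub h ih).trans (dvd_of_eq (by ring))
      · left; exact (dvd_sub h ih).trans (dvd_of_eq (by ring))
  rcases Int.natAbs_eq q with h | h
  · rw [h]; exact key _ _
  · have := key q.natAbs (m + 2 * n * q)
    rw [show m + 2 * n * q + 2 * n * (q.natAbs : ℤ) = m by
      rw [add_assoc, ← mul_add, show q + (q.natAbs : ℤ) = 0 by omega]; ring] at this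
    rwa [dvd_sub_comm, add_comm (lucasU A m)] at this

theorem exists_reduced {f n : ℤ} (hn : 0 < n)
    (hf : f ∣ 2 * lucasU A (n + 1) - A * lucasU A n) (m : ℤ) :
    ∃ r, |r| ≤ n ∧ f ∣ lucasU A m - lucasU A r ∧ (2 * n ∣ m - r ∨ 2 * n ∣ m + r) := by
  have h0 := Int.mul_ediv_add_emod (m + n) (2 * n)
  have h1 := Int.emod_nonneg (m + n) (show 2 * n ≠ 0 by omega)
  have h2 := Int.emod_lt_of_pos (m + n) (show 0 < 2 * n by omega)
  generalize (m + n) / (2 * n) = q at *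
  generalize (m + n) % (2 * n) = r at *
  have hm : m = r - n + 2 * n * q := by linear_combination -h0
  rw [hm]
  rcases dvd_sub_or_dvd_add hf (r - n) q with h | h
  · exact ⟨r - n, abs_le.mpr ⟨by omega, by omega⟩, h, Or.inl ⟨q, by ring⟩⟩
  · refine ⟨-(r - n), abs_le.mpr ⟨by omega, by omega⟩, ?_, Or.inr ⟨q, by ring⟩⟩
    rwa [neg, sub_neg_eq_add]

/-- The second step-down lemma. -/
theorem dvd_sub_or_add_of_dvd (hA : 2 ≤ |A|) {f n : ℤ} (hn : 0 < n)
    (hf : f ∣ 2 * lucasU A (n + 1) - A * lucasU A n) (hlt : 2 * |lucasU A n| < |f|) {s t : ℤ}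
    (h : f ∣ lucasU A t - lucasU A s) : 2 * n ∣ t - s ∨ 2 * n ∣ t + s := by
  obtain ⟨r, hr, hr1, hr2⟩ := exists_reduced hn hf t
  obtain ⟨r', hr', hr1', hr2'⟩ := exists_reduced hn hf s
  have h1 : f ∣ lucasU A r - lucasU A r' := by
    exact (dvd_sub (dvd_add h hr1') hr1).trans (dvd_of_eq (by ring))
  have h2 := abs_le_abs hA (hr.trans (le_abs_self n))
  have h3 := abs_le_abs hA (hr'.trans (le_abs_self n))
  have h4 : lucasU A r - lucasU A r' = 0 :=
    Int.eq_zero_of_abs_lt_dvd ((abs_dvd _ _).mpr h1) ((abs_sub _ _).trans_lt (by omega))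
  obtain rfl : r = r' := injective hA (sub_eq_zero.mp h4)
  rcases hr2 with ⟨a, ha⟩ | ⟨a, ha⟩ <;> rcases hr2' with ⟨b, hb⟩ | ⟨b, hb⟩
  · left; exact ⟨a - b, by linear_combination ha - hb⟩
  · right; exact ⟨a + b, by linear_combination ha + hb⟩
  · right; exact ⟨a + b, by linear_combination ha + hb⟩
  · left; exact ⟨a - b, by linear_combination ha - hb⟩

end lucasU

theorem Int.isSquare_of_isCoprime_mul {a b m : ℤ} (hab : IsCoprime a b) (ha : 0 ≤ a) (hb : 0 ≤ b)
    (h : a * b = m ^ 2) : (∃ x, a = x ^ 2) ∧ ∃ x, b = x ^ 2 := by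
  have key : ∀ {a b : ℤ}, IsCoprime a b → 0 ≤ a → a * b = m ^ 2 → ∃ x, a = x ^ 2 := by
    intro a b hab ha h
    obtain ⟨x, hx | hx⟩ := Int.sq_of_isCoprime hab h
    · exact ⟨x, hx⟩
    · exact ⟨0, by nlinarith [sq_nonneg x]⟩
  exact ⟨key hab ha h, key hab.symm hb (by rw [mul_comm, h])⟩

/-- Matiyasevich–Robinson style characterization of `C = u_B(A, 1)`: the square condition
together with the congruence `C ≡ B (mod A - 2)` forces the equality. -/
theorem eq_lucasU_of_isSquare {A B C D E F G H I x y : ℤ} (hB : 1 < B) (hAB : 2 * B < |A| - 2)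
    (hCB : A - 2 ∣ C - B) (hx : x ≠ 0)
    (hD : D = (A ^ 2 - 4) * C ^ 2 + 4) (hE : E = C ^ 2 * D * x)
    (hF : F = 4 * (A ^ 2 - 4) * E ^ 2 + 1)
    (hG : G = 1 + C * D * F - 2 * (A + 2) * (A - 2) ^ 2 * E ^ 2)
    (hH : H = C + B * F + (2 * y - 1) * C * F) (hI : I = (G ^ 2 - 1) * H ^ 2 + 1)
    (hsq : ∃ m : ℤ, D * F * I = m ^ 2) : C = lucasU A B := by
  have hA : 7 ≤ |A| := by omega
  have hA2 : 49 ≤ A ^ 2 := by nlinarith [sq_abs A]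
  have hA3 : |A| - 2 ≤ |A - 2| := by
    have := abs_sub_abs_le_abs_sub A 2
    rwa [abs_of_pos (show (0 : ℤ) < 2 by norm_num)] at this
  have hC : C ≠ 0 := by
    rintro rfl
    rw [zero_sub, dvd_neg] at hCB
    have := Int.eq_zero_of_abs_lt_dvd ((abs_dvd _ _).mpr hCB) (by rw [abs_of_pos] <;> omega)
    omega
  have hDpos : 0 < D := by nlinarith [sq_nonneg C]
  have hE0 : E ≠ 0 := by
    rw [hE]; exact mul_ne_zero (mul_ne_zero (pow_ne_zero _ hC) hDpos.ne') hx
  have hE2 : 0 < E ^ 2 := by positivity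
  have hF1 : 1 < F := by nlinarith
  have hDF : IsCoprime D F := ⟨-(4 * (A ^ 2 - 4) * C ^ 2 * x * E), 1, by
    rw [hF, hE]; ring⟩
  have hG2 : 2 * G = A + F * (2 * C * D - (A - 2)) := by rw [hG, hF]; ring
  have hHC : H = C + F * (B + (2 * y - 1) * C) := by rw [hH]; ring
  obtain ⟨i, hi⟩ : F ∣ D - 4 * I := by
    generalize 2 * C * D - (A - 2) = α at hG2
    generalize B + (2 * y - 1) * C = β at hHC
    refine ⟨-(α * (2 * A + F * α) * H ^ 2 + (A ^ 2 - 4) * β * (2 * C + F * β)), ?_⟩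
    have h1 : 4 * I = ((2 * G) ^ 2 - 4) * H ^ 2 + 4 := by rw [hI]; ring
    rw [h1, hG2, hHC, hD]; ring
  have hDI : IsCoprime D I := by
    obtain ⟨γ, hγ⟩ : D ∣ G - 1 := by
      refine ⟨C * F - 2 * (A + 2) * (A - 2) ^ 2 * C ^ 4 * D * x ^ 2, ?_⟩
      rw [hG, hE]; ring
    exact ⟨-(γ * (G + 1) * H ^ 2), 1, by
      rw [hI]; linear_combination (G + 1) * H ^ 2 * hγ⟩
  have hFI : IsCoprime F I := by
    obtain ⟨u, v, huv⟩ := hDF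
    exact ⟨u * i + v, 4 * u, by linear_combination huv - u * hi⟩
  obtain ⟨m, hm⟩ := hsq
  have hI0 : 0 < I := by
    by_contra hcon
    have h1 : 0 ≤ I := by
      have : 0 ≤ D * F * I := hm ▸ sq_nonneg m
      exact nonneg_of_mul_nonneg_right this (by positivity)
    have h2 : I = 0 := by omega
    rw [h2, isCoprime_zero_right, Int.isUnit_iff] at hFI
    omega
  obtain ⟨⟨d, hd⟩, i', hIsq⟩ := Int.isSquare_of_isCoprime_mul (hDI.mul_left hFI)
    (by positivity) hI0.le hm
  obtain ⟨⟨d', hDsq⟩, f, hFsq⟩ := Int.isSquare_of_isCoprime_mul hDF hDpos.le (by omega) hd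
  have hA' : 2 ≤ |A| := by omega
  obtain ⟨s, hs⟩ := lucasU.exists_of_isSquare (A := A) (c := C) ⟨d', hD ▸ hDsq⟩
  obtain ⟨n, hn0, hn⟩ : ∃ n : ℤ, 0 < n ∧ (lucasU A n = 4 * E ∨ lucasU A n = -(4 * E)) := by
    obtain ⟨n, hn⟩ := lucasU.exists_of_isSquare (A := A) (c := 4 * E) ⟨2 * f, by
      linear_combination 4 * hFsq - 4 * hF⟩
    rcases lt_trichotomy n 0 with h | h | h
    · exact ⟨-n, by omega, Or.inr (by rw [lucasU.neg, hn])⟩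
    · rw [h, lucasU.zero] at hn; omega
    · exact ⟨n, h, Or.inl hn.symm⟩
  have hnsq : lucasU A n ^ 2 = 16 * E ^ 2 := by rcases hn with h | h <;> rw [h] <;> ring
  obtain ⟨t, ht⟩ := lucasU.exists_of_isSquare (A := 2 * G) (c := H) ⟨2 * i', by
    linear_combination 4 * hIsq - 4 * hI⟩
  have hs0 : s ≠ 0 := by rintro rfl; rw [lucasU.zero] at hs; exact hC hs
  have hCn : C ∣ n := by
    rw [hs]
    refine lucasU.dvd_of_sq_dvd hA' hs0 ?_
    rw [← hs]
    have : C ^ 2 ∣ 4 * E := ⟨4 * D * x, by rw [hE]; ring⟩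
    rcases hn with h | h <;> rw [h]
    · exact this
    · exact (dvd_neg).mpr this
  have hfn : f ∣ 2 * lucasU A (n + 1) - A * lucasU A n := by
    have h1 : (2 * lucasU A (n + 1) - A * lucasU A n) ^ 2 = (2 * f) ^ 2 := by
      rw [← lucasU.discr, hnsq]; linear_combination 4 * hFsq - 4 * hF
    rcases sq_eq_sq_iff_eq_or_eq_neg.mp h1 with h | h
    · exact ⟨2, by rw [h]; ring⟩
    · exact ⟨-2, by rw [h]; ring⟩
  have hlt : 2 * |lucasU A n| < |f| := by
    have : |2 * lucasU A n| < |f| := by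
      rw [← sq_lt_sq, ← hFsq, mul_pow, hnsq]; nlinarith
    rwa [abs_mul, abs_two] at this
  have hfst : f ∣ lucasU A t - lucasU A s := by
    have h1 : F ∣ lucasU (2 * G) t - lucasU A t :=
      lucasU.modEq ⟨2 * C * D - (A - 2), by linear_combination hG2⟩ t
    rw [← ht] at h1
    have h2 : F ∣ H - C := ⟨B + (2 * y - 1) * C, by linear_combination hHC⟩
    have h3 : f ∣ F := ⟨f, by rw [hFsq]; ring⟩
    rw [← hs]
    refine h3.trans ?_
    exact (dvd_sub h2 h1).trans (dvd_of_eq (by ring))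
  have hts : 2 * C ∣ t - s ∨ 2 * C ∣ t + s :=
    (lucasU.dvd_sub_or_add_of_dvd hA' hn0 hfn hlt hfst).imp
      (mul_dvd_mul_left 2 hCn).trans (mul_dvd_mul_left 2 hCn).trans
  have hHt : 2 * C ∣ H - t := by
    have h1 : 2 * C ∣ 2 * G - 2 :=
      ⟨D * F - 2 * (A + 2) * (A - 2) ^ 2 * C ^ 3 * D ^ 2 * x ^ 2, by rw [hG, hE]; ring⟩
    rw [ht]
    exact h1.trans (lucasU.modEq_self _ t)
  have hHB : 2 * C ∣ H - B := by
    have h1 : F = 1 + 2 * C * (2 * (A ^ 2 - 4) * C ^ 3 * D ^ 2 * x ^ 2) := by rw [hF, hE]; ring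
    generalize 2 * (A ^ 2 - 4) * C ^ 3 * D ^ 2 * x ^ 2 = κ at h1
    exact ⟨y + B * κ + (2 * y - 1) * C * κ, by rw [hH, h1]; ring⟩
  have hBs : 2 * C ∣ B - s ∨ 2 * C ∣ B + s := by
    have h1 : 2 * C ∣ B - t := by exact (dvd_sub hHt hHB).trans (dvd_of_eq (by ring))
    refine hts.imp (fun h => ?_) (fun h => ?_)
    · exact (dvd_add h1 h).trans (dvd_of_eq (by ring))
    · exact (dvd_add h1 h).trans (dvd_of_eq (by ring))
  have hAs : A - 2 ∣ B - s := by
    have h1 := lucasU.modEq_self A s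
    rw [← hs] at h1
    exact (dvd_sub h1 hCB).trans (dvd_of_eq (by ring))
  have hsC : |s| ≤ |C| := hs ▸ lucasU.abs_self_le hA' s
  by_cases hBC : B < |C|
  · have hB' : |B| = B := abs_of_pos (by omega)
    have h2C : |2 * C| = 2 * |C| := by rw [abs_mul, abs_two]
    rcases hBs with h | h
    · have := Int.eq_zero_of_abs_lt_dvd ((abs_dvd _ _).mpr h)
        ((abs_sub B s).trans_lt (by omega))
      rw [hs, show B = s by omega]
    · have h0 := Int.eq_zero_of_abs_lt_dvd ((abs_dvd _ _).mpr h)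
        ((abs_add_le B s).trans_lt (by omega))
      have h1 := Int.eq_zero_of_abs_lt_dvd ((abs_dvd _ _).mpr hAs)
        (by rw [show s = -B by omega, show B - -B = 2 * B by ring, abs_of_pos] <;> omega)
      omega
  · have hCB' : C = B := by
      have h1 := Int.eq_zero_of_abs_lt_dvd ((abs_dvd _ _).mpr hCB)
        ((abs_sub C B).trans_lt (by rw [abs_of_pos (show 0 < B by omega)]; omega))
      omega
    have hB' : |lucasU A s| = B := by rw [← hs, hCB', abs_of_pos]; omega
    rcases le_or_gt |s| 1 with h | h
    · have := lucasU.abs_le_abs hA' (m := s) (n := 1) (by simpa using h)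
      rw [lucasU.one, abs_one] at this
      omega
    · have := lucasU.abs_le_abs hA' (m := 2) (n := s) (by rw [abs_two]; omega)
      have h2 := lucasU.add_two A 0
      rw [zero_add, zero_add, lucasU.one, lucasU.zero] at h2
      rw [h2, mul_one, sub_zero] at this
      omega

namespace lucasU

variable {A : ℤ}

theorem ratio_bounds (hA : 2 ≤ |A|) (n : ℕ) :
    ∃ α : ℝ, (lucasU A (n + 1) : ℝ) = α * (A : ℝ) ^ n ∧ 1 - n / |(A : ℝ)| ≤ α ∧ α ≤ 1 := by
  have hA' : (2 : ℝ) ≤ |(A : ℝ)| := by exact_mod_cast hA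
  have hA0 : (A : ℝ) ≠ 0 := by rintro h; rw [h, abs_zero] at hA'; norm_num at hA'
  set c : ℝ := ((A : ℝ) ^ 2)⁻¹ with hc
  set ε : ℝ := |(A : ℝ)|⁻¹ with hε
  have hε0 : 0 < ε := by positivity
  have hε2 : ε ≤ 1 / 2 := by
    rw [hε, one_div]; exact inv_anti₀ (by norm_num) hA'
  have hcε : c = ε ^ 2 := by rw [hc, hε, inv_pow, sq_abs]
  set a : ℕ → ℝ := fun n => (lucasU A (n + 1) : ℝ) / (A : ℝ) ^ n with ha
  have hrec : ∀ n, a (n + 2) = a (n + 1) - c * a n := by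
    intro n
    have h : lucasU A ((n + 2 : ℕ) + 1) =
        A * lucasU A ((n + 1 : ℕ) + 1) - lucasU A (n + 1) := by
      have := add_two A (n + 1)
      push_cast
      rw [← this]; congr 1
    simp only [ha, h, hc]
    push_cast
    field_simp
    ring
  have h0 : a 0 = 1 := by simp [ha, one]
  have h1 : a 1 = 1 := by
    have := add_two A 0
    rw [zero_add, zero_add, one, zero, mul_one, sub_zero] at this
    simp only [ha, Nat.cast_one, pow_one, one_add_one_eq_two, this]
    field_simp
  have key : ∀ n, 0 ≤ a n ∧ a n ≤ 1 ∧ a (n + 1) ≤ a n ∧ a n ≤ 2 * a (n + 1) ∧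
      1 - n * ε ≤ a n ∧ 1 - (n + 1 : ℕ) * ε ≤ a (n + 1) := by
    intro n
    induction n with
    | zero => simp only [h0, zero_add, h1]; norm_num; exact hε0.le
    | succ n ih =>
      obtain ⟨i1, i2, i3, i4, i5, i6⟩ := ih
      have h := hrec n
      have j1 : 0 ≤ c * a n := by rw [hcε]; positivity
      have j2 : c * a n ≤ 1 / 4 * a n := by
        refine mul_le_mul_of_nonneg_right ?_ i1
        rw [hcε]; nlinarith
      have j3 : c * a n ≤ ε := by
        rw [hcε]; nlinarith [mul_le_mul_of_nonneg_left i2 (sq_nonneg ε)]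
      refine ⟨by linarith, by linarith, by rw [h]; linarith, by rw [h]; linarith, i6, ?_⟩
      rw [h]; push_cast at i6 ⊢; linarith
  obtain ⟨-, i2, -, -, i5, -⟩ := key n
  refine ⟨a n, ?_, by rw [div_eq_mul_inv]; exact i5, i2⟩
  simp only [ha]
  field_simp

theorem abs_le_pow (hA : 2 ≤ |A|) (n : ℕ) (hn : (n : ℤ) ≤ |A|) :
    |lucasU A (n + 1)| ≤ |A| ^ n := by
  obtain ⟨α, h1, h2, h3⟩ := ratio_bounds hA n
  have hA' : (0 : ℝ) < |(A : ℝ)| := by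
    have : (2 : ℝ) ≤ |(A : ℝ)| := by exact_mod_cast hA
    linarith
  have h4 : (n : ℝ) / |(A : ℝ)| ≤ 1 := by
    rw [div_le_one hA']; exact_mod_cast hn
  have : |(lucasU A (n + 1) : ℝ)| ≤ |(A : ℝ)| ^ n := by
    rw [h1, abs_mul, abs_pow, abs_of_nonneg (by linarith)]
    exact mul_le_of_le_one_left (by positivity) h3
  exact_mod_cast this

/-- Two Lucas numbers of comparable size: if `u_{N+1}(U^Q (V+1)) / u_{M+1}(U^P V)` is within
`1/2` of `L`, then so, nearly, is `(V+1)^N / V^M`. -/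
theorem quotient_approx {U V L : ℤ} {P Q N M : ℕ} (hQ : Q ≠ 0) (hP : P ≠ 0) (hN : N ≠ 0)
    (hMN : M ≤ N)
    (hQN : Q * N = P * M) (hU : |U| = N * |L|) (hL : L ≠ 0) (hV : 17 ≤ |V|)
    (h : 4 * (lucasU (U ^ Q * (V + 1)) (N + 1) - lucasU (U ^ P * V) (M + 1) * L) ^ 2 <
      lucasU (U ^ P * V) (M + 1) ^ 2) :
    4 * |(V + 1) ^ N - L * V ^ M| < 3 * |V| ^ M ∧ |V + 1| ^ N ≤ 2 * |L| * |V| ^ M := by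
  have hL1 : 1 ≤ |L| := Int.one_le_abs hL
  have hN1 : (1 : ℤ) ≤ N := by exact_mod_cast Nat.one_le_iff_ne_zero.mpr hN
  have hU1 : 1 ≤ |U| := by rw [hU]; nlinarith
  have hU0 : U ≠ 0 := by rintro rfl; simp at hU1
  have hV1 : 16 ≤ |V + 1| := by
    have := abs_sub_abs_le_abs_sub V (-1)
    rw [sub_neg_eq_add, abs_neg, abs_one] at this
    omega
  have hsize : ∀ (k : ℕ) (v : ℤ), k ≠ 0 → 16 ≤ |v| → 16 * (N * |L|) ≤ |U ^ k * v| := by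
    intro k v hk hv
    rw [abs_mul, abs_pow, ← hU]
    have := le_self_pow₀ hU1 hk
    nlinarith
  have hA := hsize Q (V + 1) hQ hV1
  have hA' := hsize P V hP (by omega)
  have hNL : 1 ≤ N * |L| := by nlinarith
  obtain ⟨α, e1, e2, e3⟩ := ratio_bounds (A := U ^ Q * (V + 1)) (by omega) N
  obtain ⟨β, f1, f2, f3⟩ := ratio_bounds (A := U ^ P * V) (by omega) M
  set ℓ : ℝ := |(L : ℝ)| with hℓ
  have hℓ1 : 1 ≤ ℓ := by rw [hℓ]; exact_mod_cast hL1
  set δ : ℝ := 1 / (16 * ℓ) with hδ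
  have hδℓ : δ * ℓ = 1 / 16 := by rw [hδ]; field_simp
  have hδ0 : 0 < δ := by positivity
  have hδ1 : δ ≤ 1 / 16 := by nlinarith
  have hbound : ∀ (k : ℕ) (A : ℤ), k ≤ N → 16 * (N * |L|) ≤ |A| → (k : ℝ) / |(A : ℝ)| ≤ δ := by
    intro k A hk hA
    have h1 : 16 * (N * ℓ) ≤ |(A : ℝ)| := by rw [hℓ]; exact_mod_cast hA
    have h2 : (k : ℝ) ≤ N := by exact_mod_cast hk
    have h3 : (1 : ℝ) ≤ N := by exact_mod_cast hN1
    have h4 : 0 < |(A : ℝ)| := by nlinarith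
    rw [div_le_iff₀ h4]
    have h5 : δ * (16 * (N * ℓ)) = N := by linear_combination 16 * N * hδℓ
    nlinarith
  have hα : 1 - δ ≤ α := by linarith [hbound N _ le_rfl hA]
  have hβ : 1 - δ ≤ β := by linarith [hbound M _ hMN hA']
  set T : ℝ := (U : ℝ) ^ (Q * N) with hT
  set z : ℝ := ((V : ℝ) + 1) ^ N with hz
  set y : ℝ := (V : ℝ) ^ M with hy
  have hT0 : T ≠ 0 := pow_ne_zero _ (by exact_mod_cast hU0)
  have hy0 : 0 < |y| := by
    have : V ≠ 0 := by rintro rfl; simp at hV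
    rw [abs_pos]; exact pow_ne_zero _ (by exact_mod_cast this)
  have g1 : ((lucasU (U ^ Q * (V + 1)) (N + 1) : ℤ) : ℝ) = α * z * T := by
    rw [e1]; push_cast; rw [mul_pow, ← pow_mul]; ring
  have g2 : ((lucasU (U ^ P * V) (M + 1) : ℤ) : ℝ) = β * y * T := by
    rw [f1]; push_cast; rw [mul_pow, ← pow_mul, ← hQN]; ring
  have h' : 4 * (((lucasU (U ^ Q * (V + 1)) (N + 1) : ℤ) : ℝ) -
      ((lucasU (U ^ P * V) (M + 1) : ℤ) : ℝ) * L) ^ 2 <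
      ((lucasU (U ^ P * V) (M + 1) : ℤ) : ℝ) ^ 2 := by exact_mod_cast h
  rw [g1, g2] at h'
  have h2 : (2 * (α * z - β * y * L)) ^ 2 < (β * y) ^ 2 := by
    have : 0 < T ^ 2 := by positivity
    refine lt_of_mul_lt_mul_right (a := T ^ 2) ?_ this.le
    calc _ = 4 * (α * z * T - β * y * T * L) ^ 2 := by ring
      _ < _ := h'
      _ = _ := by ring
  rw [sq_lt_sq, abs_mul, abs_two, abs_mul, abs_of_nonneg (show 0 ≤ β by linarith)] at h2
  have h3 : β * |y| ≤ |y| := mul_le_of_le_one_left hy0.le f3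
  have h4 : α * |z| ≤ |α * z - β * y * L| + β * (ℓ * |y|) := by
    have h5 := abs_add_le (α * z - β * y * L) (β * y * L)
    rw [sub_add_cancel, abs_mul α, abs_mul (β * y), abs_mul β, abs_of_nonneg (show 0 ≤ β by linarith),
      abs_of_nonneg (show 0 ≤ α by linarith)] at h5
    linarith
  have h5 : β * (ℓ * |y|) ≤ ℓ * |y| := mul_le_of_le_one_left (by positivity) f3
  have h6 : |y| ≤ ℓ * |y| := le_mul_of_one_le_left hy0.le hℓ1
  have h7 : |z| ≤ 2 * (ℓ * |y|) := by nlinarith [abs_nonneg z]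
  have h8 : |z - L * y| ≤ |α * z - β * y * L| + (1 - α) * |z| + (1 - β) * (ℓ * |y|) := by
    have k1 : z - L * y = (α * z - β * y * L) + (1 - α) * z + -((1 - β) * (L * y)) := by ring
    rw [k1]
    refine (abs_add_three _ _ _).trans ?_
    rw [abs_neg, abs_mul (1 - α), abs_mul (1 - β), abs_mul (L : ℝ),
      abs_of_nonneg (show 0 ≤ 1 - α by linarith), abs_of_nonneg (show 0 ≤ 1 - β by linarith)]
  have h9 : (1 - α) * |z| ≤ δ * (2 * (ℓ * |y|)) := by
    apply mul_le_mul (by linarith) h7 (abs_nonneg _) hδ0.le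
  have h10 : (1 - β) * (ℓ * |y|) ≤ δ * (ℓ * |y|) := by
    apply mul_le_mul_of_nonneg_right (by linarith) (by positivity)
  have h11 : δ * (ℓ * |y|) = |y| / 16 := by rw [← mul_assoc, hδℓ]; ring
  constructor
  · have : 4 * |z - L * y| < 3 * |y| := by linarith
    rw [hz, hy, abs_pow (V : ℝ)] at this
    exact_mod_cast this
  · have : |z| ≤ 2 * ℓ * |y| := by linarith
    rw [hz, hy, hℓ, abs_pow, abs_pow] at this
    exact_mod_cast this

/-- A size comparison that pins down the index of a Lucas number known modulo `A - 2`. -/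
theorem index_eq {a C K n : ℤ} {N M : ℕ} (hMN : M ≤ N) (hA : 2 * N + 5 < |A|) (ha : |a| < |A|)
    (hC : |C| ≤ |a| ^ N) (hKC : |K| ≤ 2 * |C|) (hK : K = lucasU A n)
    (hn : A - 2 ∣ n - (M + 1)) : n = M + 1 := by
  by_contra hne
  have h1 : |A - 2| ≤ |n - (M + 1)| := by
    by_contra hcon
    have := Int.eq_zero_of_abs_lt_dvd ((abs_dvd _ _).mpr hn) (by omega)
    omega
  have habs := abs_sub_abs_le_abs_sub A 2
  have habs' := abs_sub n (M + 1 : ℤ)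
  rw [abs_two] at habs
  rw [Int.abs_eq_natAbs n, abs_of_nonneg (show (0 : ℤ) ≤ M + 1 by omega)] at habs'
  obtain ⟨k, hk⟩ : ∃ k, n.natAbs = k + 1 := ⟨n.natAbs - 1, by omega⟩
  have h2 : N + 2 ≤ k := by omega
  have h3 : (|A| - 1) ^ (N + 2) ≤ |K| := by
    rw [hK, ← abs_natAbs, hk]
    exact (pow_le_pow_right₀ (by omega) h2).trans (pow_le_abs (by omega) k)
  have h4 : |a| ^ N ≤ (|A| - 1) ^ N := pow_le_pow_left₀ (abs_nonneg _) (by omega) _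
  have h5 : 0 < (|A| - 1) ^ N := pow_pos (by omega) _
  have h6 : 3 ≤ |A| - 1 := by omega
  have h7 : (|A| - 1) ^ (N + 2) = (|A| - 1) ^ N * (|A| - 1) ^ 2 := pow_add _ _ _
  have h8 : (|A| - 1) ^ N * 3 ≤ (|A| - 1) ^ N * (|A| - 1) ^ 2 :=
    mul_le_mul_of_nonneg_left (by nlinarith) h5.le
  omega

theorem dvd_prime_power_form (A p : ℤ) (n : ℕ) :
    p * A - p ^ 2 - 1 ∣ (p ^ 2 - 1) * p ^ n * lucasU A n - p * (p ^ (2 * n) - 1) := by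
  suffices h : p * A - p ^ 2 - 1 ∣ (p ^ 2 - 1) * p ^ n * lucasU A n - p * (p ^ (2 * n) - 1) ∧
      p * A - p ^ 2 - 1 ∣ (p ^ 2 - 1) * p ^ (n + 1) * lucasU A (n + 1) -
        p * (p ^ (2 * (n + 1)) - 1) from h.1
  induction n with
  | zero => exact ⟨by simp [zero], ⟨0, by simp [one]; ring⟩⟩
  | succ n ih =>
    obtain ⟨⟨r, hr⟩, s, hs⟩ := ih
    refine ⟨⟨s, by push_cast; exact hs⟩, ?_⟩
    have e := add_two A n
    rw [show ((n + 1 : ℕ) : ℤ) + 1 = n + 2 by push_cast; ring, e]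
    refine ⟨p * A * s - p ^ 2 * r + p * (p ^ (2 * (n + 1)) - 1), ?_⟩
    linear_combination p * A * hs - p ^ 2 * hr

end lucasU

theorem exists_eq_mul_pow_add (V : ℤ) (hV : 1 ≤ V) {N M : ℕ} (hMN : M ≤ N) :
    ∃ T S : ℤ, (V + 1) ^ N = T * V ^ M + S ∧ V ∣ T - N.choose M ∧ 0 ≤ S ∧
      S * V ≤ 2 ^ N * V ^ M := by
  obtain ⟨k, rfl⟩ := Nat.exists_eq_add_of_le hMN
  refine ⟨∑ i ∈ Finset.range (k + 1), ((M + k).choose (M + i) : ℤ) * V ^ i,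
    ∑ i ∈ Finset.range M, ((M + k).choose i : ℤ) * V ^ i, ?_, ?_, ?_, ?_⟩
  · rw [add_pow, add_assoc, Finset.sum_range_add, add_comm, Finset.sum_mul]
    congr 1
    · refine Finset.sum_congr rfl fun i _ => ?_
      rw [pow_add]; simp; ring
    · refine Finset.sum_congr rfl fun i _ => ?_
      simp; ring
  · rw [Finset.sum_range_succ']
    simp only [add_zero, pow_zero, mul_one, add_sub_cancel_right]
    exact Finset.dvd_sum fun i _ => (dvd_pow_self _ (Nat.succ_ne_zero i)).mul_left _
  · exact Finset.sum_nonneg fun i _ => by positivity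
  · calc _ = ∑ i ∈ Finset.range M, ((M + k).choose i : ℤ) * V ^ (i + 1) := by
          rw [Finset.sum_mul]
          exact Finset.sum_congr rfl fun i _ => by ring
      _ ≤ ∑ i ∈ Finset.range M, ((M + k).choose i : ℤ) * V ^ M := by
          refine Finset.sum_le_sum fun i hi => ?_
          rw [Finset.mem_range] at hi
          exact mul_le_mul_of_nonneg_left (pow_le_pow_right₀ hV hi) (by positivity)
      _ ≤ ∑ i ∈ Finset.range (M + k + 1), ((M + k).choose i : ℤ) * V ^ M := by
          refine Finset.sum_le_sum_of_subset_of_nonneg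
            (Finset.range_subset_range.mpr (by omega)) fun i _ _ => by positivity
      _ = _ := by
          rw [← Finset.sum_mul]
          congr 1
          exact_mod_cast Nat.sum_range_choose (M + k)

theorem pow_le_two_mul_sub_one_pow {v : ℤ} {P : ℕ} (hv : 1 ≤ v) (hP : 2 * P ≤ v) :
    v ^ P ≤ 2 * (v - 1) ^ P := by
  have key : ∀ k : ℕ, (v - k) * v ^ k ≤ v * (v - 1) ^ k := by
    intro k
    induction k with
    | zero => simp
    | succ k ih =>
      have h1 := mul_le_mul_of_nonneg_right ih (show 0 ≤ v - 1 by omega)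
      have h2 : 0 ≤ k * v ^ k := by positivity
      push_cast
      rw [pow_succ, pow_succ]
      nlinarith
  have h1 : 0 < v ^ P := by positivity
  refine le_of_mul_le_mul_left (a := v) ?_ (by omega)
  nlinarith [key P]

theorem le_of_pow_le {p P Q X : ℕ} {v ℓ : ℤ} (hp : 2 ≤ p) (hQP : Q < P) (hP : 2 ≤ P) (hX : 3 ≤ X)
    (hv : 4 * (p : ℤ) ^ (4 * P) ≤ v) (h : (v - 1) ^ (P * X) ≤ 2 * ℓ * v ^ (Q * X)) :
    v * (p ^ (P * X + 1)) ^ 2 ≤ ℓ := by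
  have hp1 : (1 : ℤ) ≤ p := by omega
  have hpP : (P : ℤ) ≤ (p : ℤ) ^ (4 * P) := by
    have h1 : P < p ^ P := Nat.lt_pow_self (by omega)
    have h2 : p ^ P ≤ p ^ (4 * P) := Nat.pow_le_pow_right (by omega) (by omega)
    exact_mod_cast h1.le.trans h2
  generalize hr : (p : ℤ) ^ (4 * P) = r at *
  have hv1 : 1 ≤ v := by omega
  have h1 := pow_le_pow_left₀ (by positivity) (pow_le_two_mul_sub_one_pow (P := P) hv1 (by omega)) X
  rw [mul_pow, ← pow_mul, ← pow_mul] at h1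
  have h2 : v ^ (Q * X) * v ^ X ≤ v ^ (P * X) := by
    rw [← pow_add]
    exact pow_le_pow_right₀ hv1 (by nlinarith)
  have h3 : v ^ X ≤ 2 ^ X * (2 * ℓ) := by
    refine le_of_mul_le_mul_left (a := v ^ (Q * X)) ?_ (by positivity)
    calc _ ≤ _ := h2
      _ ≤ _ := h1
      _ ≤ _ := mul_le_mul_of_nonneg_left h (by positivity)
      _ = _ := by ring
  obtain ⟨j, rfl⟩ : ∃ j, X = j + 1 := ⟨X - 1, by omega⟩
  have h4 : (4 * r) ^ j ≤ v ^ j := pow_le_pow_left₀ (by omega) hv j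
  have h5 : (2 : ℤ) ^ 2 ≤ 2 ^ j := pow_le_pow_right₀ (by norm_num) (by omega)
  have h6 : ((p : ℤ) ^ (P * (j + 1) + 1)) ^ 2 ≤ r ^ j := by
    rw [← hr, ← pow_mul, ← pow_mul]
    exact pow_le_pow_right₀ hp1 (by nlinarith)
  have h7 : (4 * r) ^ j = 2 ^ j * (2 ^ j * r ^ j) := by
    rw [← mul_assoc, ← mul_pow, ← mul_pow]; norm_num
  rw [pow_succ, pow_succ] at h3
  have h8 : v * (2 ^ j * r ^ j) ≤ 4 * ℓ := by
    refine le_of_mul_le_mul_left (a := (2 : ℤ) ^ j) ?_ (by positivity)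
    calc _ = (4 * r) ^ j * v := by rw [h7]; ring
      _ ≤ v ^ j * v := mul_le_mul_of_nonneg_right h4 (by omega)
      _ ≤ _ := h3
      _ = _ := by ring
  have h9 : 0 ≤ v * r ^ j := mul_nonneg (by omega) (pow_nonneg (by omega) _)
  have h10 : 2 ^ 2 * (v * r ^ j) ≤ 2 ^ j * (v * r ^ j) := mul_le_mul_of_nonneg_right h5 h9
  have h11 := mul_le_mul_of_nonneg_left h6 (show 0 ≤ v by omega)
  linarith

theorem mul_abs_le_abs_form {p : ℤ} (hp : 0 ≤ p) (A : ℤ) :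
    p * |A| ≤ |p * A - p ^ 2 - 1| + (p ^ 2 + 1) := by
  have h1 := abs_sub_abs_le_abs_sub (p * A) (p ^ 2 + 1)
  rw [abs_mul, abs_of_nonneg hp, abs_of_pos (show 0 < p ^ 2 + 1 by positivity)] at h1
  rw [sub_sub]
  linarith

theorem not_form_dvd {p A : ℤ} (hp : 2 ≤ p) (hA : A = 0 ∨ p ^ 4 ≤ |A|) :
    ¬ p * A - p ^ 2 - 1 ∣ p := by
  intro h1
  have h2 := Int.le_of_dvd (by omega) ((abs_dvd _ _).mpr h1)
  have h6 : 2 * p ≤ p ^ 2 := by nlinarith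
  rcases hA with rfl | hA
  · rw [show p * 0 - p ^ 2 - 1 = -(p ^ 2 + 1) by ring, abs_neg,
      abs_of_pos (by positivity)] at h2
    omega
  · have h3 := mul_abs_le_abs_form (show 0 ≤ p by omega) A
    have h4 : 2 * |A| ≤ p * |A| := mul_le_mul_of_nonneg_right hp (abs_nonneg _)
    have h5 : 4 * p ^ 2 ≤ p ^ 4 := by nlinarith
    omega

theorem eq_of_form_dvd {p q A C W V : ℤ} (hp : 2 ≤ p) (hpq : p ≤ q) (hW : W ≠ 0)
    (hWV : 4 * |W| ≤ V) (hV : 1000 ≤ V) (hA : 6 * (V * q ^ 2) * (V - 1) ≤ |A|)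
    (hdW : p * A - p ^ 2 - 1 ∣ (p ^ 2 - 1) * W * C - p * (W ^ 2 - 1))
    (hdq : p * A - p ^ 2 - 1 ∣ (p ^ 2 - 1) * q * C - p * (q ^ 2 - 1)) : W = q := by
  have hcop : IsCoprime (p * A - p ^ 2 - 1) p := ⟨-1, A - p, by ring⟩
  have h1 : p * A - p ^ 2 - 1 ∣ p * ((W * q + 1) * (W - q)) :=
    (dvd_sub (hdq.mul_left W) (hdW.mul_left q)).trans (dvd_of_eq (by ring))
  have h2 := hcop.dvd_of_dvd_mul_left h1
  have hW1 := Int.one_le_abs hW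
  have hq0 : 0 < q := by omega
  have h3 : (W * q + 1) * (W - q) = 0 := by
    refine Int.eq_zero_of_abs_lt_dvd ((abs_dvd _ _).mpr h2) ?_
    have k0 : |W| ≤ |W| * q := le_mul_of_one_le_right (by omega) (by omega)
    have k0' : q ≤ |W| * q := le_mul_of_one_le_left (by omega) (by omega)
    have k1 : |W * q + 1| ≤ 2 * (|W| * q) := by
      have := abs_add_le (W * q) 1
      rw [abs_mul, abs_of_pos hq0, abs_one] at this
      omega
    have k2 : |W - q| ≤ 2 * (|W| * q) := by
      have := abs_sub W q
      rw [abs_of_pos hq0] at this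
      omega
    have k3 : 4 * (|W| * q) ≤ V * q := by
      rw [← mul_assoc]; exact mul_le_mul_of_nonneg_right hWV hq0.le
    have k4 : |(W * q + 1) * (W - q)| ≤ (V * q) * (V * q) := by
      rw [abs_mul]
      exact mul_le_mul (by omega) (by omega) (abs_nonneg _) (by positivity)
    have k5 := mul_abs_le_abs_form (show 0 ≤ p by omega) A
    have k6 : 2 * |A| ≤ p * |A| := mul_le_mul_of_nonneg_right hp (abs_nonneg _)
    have k7 : p ^ 2 ≤ q ^ 2 := pow_le_pow_left₀ (by omega) hpq 2
    have k8 : 0 < q ^ 2 := by positivity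
    have k9 : 1000 * (V * q ^ 2) ≤ V * (V * q ^ 2) :=
      mul_le_mul_of_nonneg_right hV (by positivity)
    have k10 : 1000 * q ^ 2 ≤ V * q ^ 2 := mul_le_mul_of_nonneg_right hV k8.le
    have k11 : (V * q) * (V * q) = V * (V * q ^ 2) := by ring
    have k12 : 6 * (V * q ^ 2) * (V - 1) = 6 * (V * (V * q ^ 2)) - 6 * (V * q ^ 2) := by ring
    omega
  rcases mul_eq_zero.mp h3 with h4 | h4
  · have := Int.le_of_dvd one_pos (show q ∣ 1 from ⟨-W, by linear_combination h4⟩)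
    omega
  · omega

theorem dvd_choose_of_approx {V L Y : ℤ} {N M : ℕ} (hMN : M ≤ N) (hV : 8 * 2 ^ N ≤ V)
    (h : 4 * |(V + 1) ^ N - L * V ^ M| < 3 * V ^ M) (hYV : Y ∣ V) (hYL : Y ∣ L) :
    Y ∣ (N.choose M : ℤ) := by
  have h2N : (0 : ℤ) < 2 ^ N := by positivity
  have hV0 : 0 < V := by omega
  obtain ⟨T, S, f1, f2, f3, f4⟩ := exists_eq_mul_pow_add V hV0 hMN
  have hVM : 0 < V ^ M := by positivity
  have h8S : 8 * S ≤ V ^ M := by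
    refine le_of_mul_le_mul_left (a := (2 : ℤ) ^ N) ?_ h2N
    have := mul_le_mul_of_nonneg_right hV f3
    linarith
  have hTL : T = L := by
    by_contra hne
    have h1 : 1 ≤ |T - L| := Int.one_le_abs (sub_ne_zero.mpr hne)
    have h2 : |(T - L) * V ^ M| ≤ |(V + 1) ^ N - L * V ^ M| + |S| := by
      rw [show (T - L) * V ^ M = ((V + 1) ^ N - L * V ^ M) - S by rw [f1]; ring]
      exact abs_sub _ _
    rw [abs_mul, abs_of_pos hVM, abs_of_nonneg f3] at h2
    have h3 := le_mul_of_one_le_left hVM.le h1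
    linarith
  rw [← hTL] at hYL
  exact (dvd_sub_right hYL).mp (hYV.trans f2)

theorem prime_pow_and_dvd_choose_of_lucasU {p P Q X : ℕ} (hp : p.Prime) (hQ : 0 < Q) (hPQ : Q < P)
    {b g Y k l w L U V W K A C : ℤ} (hb : 0 ≤ b) (hg : 0 < g) (hX : 3 * b ≤ X) (hYb : b ≤ Y)
    (hYp : (p : ℤ) ^ (4 * P) ≤ Y) (hl : l ≠ 0) (hL : L = l * Y) (hU : U = P * L * X)
    (hV : V = 4 * g * w * Y) (hW : W = b * w) (hK : K = Q * X + 1 + k * (U ^ P * V - 2))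
    (hA : A = U ^ Q * (V + 1))
    (hC : 1 < (P * X + 1 : ℤ) → 2 * (P * X + 1 : ℤ) < |A| - 2 → C = lucasU A (P * X + 1))
    (hKsq : ∃ m : ℤ, (U ^ (2 * P) * V ^ 2 - 4) * K ^ 2 + 4 = m ^ 2)
    (hdvd : (p : ℤ) * A - (p : ℤ) ^ 2 - 1 ∣ ((p : ℤ) ^ 2 - 1) * W * C - (p : ℤ) * (W ^ 2 - 1))
    (hlt : 4 * (C - K * L) ^ 2 < K ^ 2) :
    (∃ n : ℕ, b = (p : ℤ) ^ n) ∧ Y ∣ ((P * X).choose (Q * X) : ℤ) := by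
  have hp2 : (2 : ℤ) ≤ p := by exact_mod_cast hp.two_le
  have hp4 : (p : ℤ) ^ 4 ≤ Y := (pow_le_pow_right₀ (by omega) (by omega)).trans hYp
  have hY : 256 ≤ Y := by
    have h1 : (2 : ℤ) ^ 8 ≤ 2 ^ (4 * P) := pow_le_pow_right₀ (by norm_num) (by omega)
    have h2 : (2 : ℤ) ^ (4 * P) ≤ p ^ (4 * P) := pow_le_pow_left₀ (by norm_num) hp2 _
    norm_num at h1
    omega
  have hY0 : |Y| = Y := abs_of_pos (by omega)
  have hLY : Y ≤ |L| := by
    rw [hL, abs_mul, hY0]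
    exact le_mul_of_one_le_left (by omega) (Int.one_le_abs hl)
  have hUabs : |U| = (P * X : ℕ) * |L| := by
    rw [hU, abs_mul, abs_mul, Nat.abs_cast, Nat.abs_cast]; push_cast; ring
  have hV1 : 1 ≤ |V + 1| := Int.one_le_abs (by rw [hV, mul_assoc, mul_assoc]; omega)
  have hAabs : |A| = |U| ^ Q * |V + 1| := by rw [hA, abs_mul, abs_pow]
  have hUL : 0 < X → |L| ≤ |U| := by
    intro hX0
    have : (1 : ℤ) ≤ (P * X : ℕ) := by
      have : 0 < P * X := Nat.mul_pos (by omega) hX0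
      exact_mod_cast this
    rw [hUabs]; exact le_mul_of_one_le_left (abs_nonneg _) this
  have hAU : 0 < X → |U| * |V + 1| ≤ |A| := by
    intro hX0
    rw [hAabs]
    exact mul_le_mul_of_nonneg_right (le_self_pow₀ (by have := hUL hX0; omega) (by omega))
      (by omega)
  have hW0 : W ≠ 0 := by
    intro hW0
    rw [hW0] at hdvd
    refine not_form_dvd hp2 ?_ (hdvd.trans (dvd_of_eq (by ring)))
    rcases Nat.eq_zero_or_pos X with hX0 | hX0
    · left
      rw [hA, hU, hX0]
      simp [hQ.ne']
    · right
      have h3 := hUL hX0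
      have h4 := hAU hX0
      have h5 := le_mul_of_one_le_right (abs_nonneg U) hV1
      linarith
  have hb1 : 1 ≤ b := by
    rcases hb.eq_or_lt with h0 | h0
    · rw [← h0, zero_mul] at hW; exact absurd hW hW0
    · omega
  have hw0 : w ≠ 0 := by rintro rfl; rw [mul_zero] at hW; exact hW0 hW
  have hw1 := Int.one_le_abs hw0
  have hX3 : 3 ≤ X := by omega
  have hVabs : 4 * (|w| * Y) ≤ |V| := by
    rw [hV, abs_mul, abs_mul, abs_mul, hY0, abs_of_pos hg]
    have h1 : 0 ≤ |w| * Y := mul_nonneg (abs_nonneg w) (by omega)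
    have h2 : |w| * Y ≤ g * (|w| * Y) := le_mul_of_one_le_left h1 hg
    rw [abs_of_pos (show (0 : ℤ) < 4 by norm_num)]
    linarith
  have hVY : 4 * Y ≤ |V| := by
    have := le_mul_of_one_le_left (show 0 ≤ Y by omega) hw1
    linarith
  have hWV : 4 * |W| ≤ |V| := by
    rw [hW, abs_mul, abs_of_pos (show 0 < b by omega)]
    have := mul_le_mul_of_nonneg_left hYb (abs_nonneg w)
    linarith
  have hVV : |V| - 1 ≤ |V + 1| := by
    have := abs_sub_abs_le_abs_sub V (-1)
    rwa [sub_neg_eq_add, abs_neg, abs_one] at this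
  have hVV' : |V + 1| ≤ |V| + 1 := by simpa using abs_add_le V 1
  obtain ⟨N, hN⟩ : ∃ N, N = P * X := ⟨_, rfl⟩
  obtain ⟨M, hM⟩ : ∃ M, M = Q * X := ⟨_, rfl⟩
  have hMN : M ≤ N := by rw [hN, hM]; exact Nat.mul_le_mul_right _ hPQ.le
  have hN6 : 6 ≤ N := by rw [hN]; exact Nat.mul_le_mul (show 2 ≤ P by omega) hX3
  have hN6' : (6 : ℤ) ≤ N := by exact_mod_cast hN6
  have hPX : (P * X : ℤ) = N := by rw [hN]; push_cast; rfl
  have hQX : (Q * X : ℤ) = M := by rw [hM]; push_cast; rfl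
  rw [← hN] at hUabs ⊢
  rw [← hM]
  rw [hPX] at hC
  rw [hQX] at hK
  have hUN : 256 * N ≤ |U| := by
    rw [hUabs, mul_comm]; exact mul_le_mul_of_nonneg_left (hY.trans hLY) (by omega)
  have hAL : N * |L| * (|V| - 1) ≤ |A| := by
    rw [← hUabs]
    exact (mul_le_mul_of_nonneg_left hVV (abs_nonneg _)).trans (hAU (by omega))
  have hUA : |U| ≤ |A| := 
    (le_mul_of_one_le_right (abs_nonneg _) hV1).trans (hAU (by omega))
  replace hC := hC (by omega) (by omega)
  have hAA' : |A| < |U ^ P * V| := by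
    have h1 : |U| ^ Q * |U| ≤ |U| ^ P := by
      rw [← pow_succ]; exact pow_le_pow_right₀ (by omega) hPQ
    have h2 : 0 < |U| ^ Q := pow_pos (by omega) _
    have h3 : |V| + 1 < |U| * |V| := by
      have := mul_le_mul_of_nonneg_right (show 2 ≤ |U| by omega) (abs_nonneg V)
      omega
    rw [hAabs, abs_mul, abs_pow]
    calc _ ≤ |U| ^ Q * (|V| + 1) := mul_le_mul_of_nonneg_left hVV' h2.le
      _ < |U| ^ Q * (|U| * |V|) := mul_lt_mul_of_pos_left h3 h2
      _ = |U| ^ Q * |U| * |V| := by ring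
      _ ≤ _ := mul_le_mul_of_nonneg_right h1 (abs_nonneg _)
  have hKL : K = lucasU (U ^ P * V) (M + 1) := by
    obtain ⟨n, hn⟩ := lucasU.exists_of_isSquare (A := U ^ P * V) (c := K) (by
      rwa [mul_pow, ← pow_mul, mul_comm P 2])
    have h1 : U ^ P * V - 2 ∣ n - (M + 1) := by
      have h2 := lucasU.modEq_self (U ^ P * V) n
      rw [← hn] at h2
      have h3 : U ^ P * V - 2 ∣ K - (M + 1) := ⟨k, by rw [hK]; ring⟩
      exact (dvd_sub h3 h2).trans (dvd_of_eq (by ring))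
    have h2 : |K| ≤ 2 * |C| := by
      have h3 : (2 * (C - K * L)) ^ 2 < K ^ 2 := by linarith
      rw [sq_lt_sq, abs_mul, abs_two] at h3
      have h4 := abs_sub_abs_le_abs_sub (K * L) C
      rw [abs_sub_comm (K * L) C, abs_mul] at h4
      have h6 := mul_le_mul_of_nonneg_left (show 2 ≤ |L| by omega) (abs_nonneg K)
      linarith [abs_nonneg K]
    rw [← lucasU.index_eq hMN (by omega) hAA' (hC ▸ lucasU.abs_le_pow (by omega) N (by omega))
      h2 hn h1, hn]
  have hL0 : L ≠ 0 := by rintro rfl; rw [abs_zero] at hLY; omega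
  obtain ⟨e1, e2⟩ := lucasU.quotient_approx (U := U) (V := V) (L := L) hQ.ne' (by omega)
    (show N ≠ 0 by omega) hMN (show Q * N = P * M by rw [hN, hM]; ring) hUabs hL0 (show 17 ≤ |V| by omega)
    (by rw [← hA, ← hC, ← hKL]; exact hlt)
  obtain ⟨q, hq⟩ : ∃ q : ℤ, q = p ^ (N + 1) := ⟨_, rfl⟩
  have hLq : |V| * q ^ 2 ≤ |L| := by
    rw [hq, hN]
    refine le_of_pow_le hp.two_le hPQ (by omega) hX3 (by omega) ?_
    rw [← hN, ← hM]
    exact (pow_le_pow_left₀ (by omega) hVV N).trans e2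
  have hpq : p ≤ q := by rw [hq]; exact le_self_pow₀ (by omega) (by omega)
  have hWq : W = q := by
    have h1 := lucasU.dvd_prime_power_form A p (N + 1)
    rw [mul_comm 2, pow_mul, ← hq, Nat.cast_add_one, ← hC] at h1
    have h2 : 6 * (|V| * q ^ 2) * (|V| - 1) ≤ |A| :=
      le_trans (mul_le_mul_of_nonneg_right
        (mul_le_mul hN6' hLq (by positivity) (by omega)) (by omega)) hAL
    exact eq_of_form_dvd hp2 hpq hW0 hWV (by omega) h2 hdvd h1
  constructor
  · have h1 : b.natAbs ∣ p ^ (N + 1) := by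
      rw [← Int.natCast_dvd_natCast, Int.natAbs_dvd]
      push_cast
      exact ⟨w, by rw [← hq, ← hWq, hW]⟩
    obtain ⟨n, -, hn⟩ := (Nat.dvd_prime_pow hp).mp h1
    refine ⟨n, ?_⟩
    have : (b.natAbs : ℤ) = p ^ n := by rw [hn]; push_cast; rfl
    omega
  · have hVpos : 0 < V := by
      have h1 : 0 < b * w := by rw [← hW, hWq]; omega
      have h2 : 0 < w := pos_of_mul_pos_right h1 hb
      rw [hV]; positivity
    rw [abs_of_pos hVpos] at e1 hWV
    have hVN : 8 * 2 ^ N ≤ V := by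
      have h1 : (2 : ℤ) ^ (N + 1) ≤ q := hq ▸ pow_le_pow_left₀ (by norm_num) hp2 _
      rw [hWq, abs_of_pos (show 0 < q by omega)] at hWV
      rw [pow_succ] at h1
      omega
    exact dvd_choose_of_approx hMN hVN e1 ⟨4 * g * w, by rw [hV]; ring⟩
      (hL ▸ dvd_mul_left _ _)

theorem stmt17 (p : ℕ) (hp : p.Prime) (b g P Q X Y : ℤ)
    (hb : 0 ≤ b) (hg : 0 < g)
    (hQ : 0 < Q) (hPQ : Q < P) (hX : 3 * b ≤ X)
    (hYb : b ≤ Y) (hYp : (p : ℤ) ^ (4 * P).toNat ≤ Y)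
    (hexists : ∃ h k l w x y : ℤ, l * x ≠ 0 ∧
      let L := l * Y
      let U := P * L * X
      let V := 4 * g * w * Y
      let W := b * w
      let K := Q * X + 1 + k * (U ^ P.toNat * V - 2)
      let A := U ^ Q.toNat * (V + 1)
      let B := P * X + 1
      let C := B + (A - 2) * h
      let D := (A ^ 2 - 4) * C ^ 2 + 4
      let E := C ^ 2 * D * x
      let F := 4 * (A ^ 2 - 4) * E ^ 2 + 1
      let G := 1 + C * D * F - 2 * (A + 2) * (A - 2) ^ 2 * E ^ 2
      let H := C + B * F + (2 * y - 1) * C * F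
      let I := (G ^ 2 - 1) * H ^ 2 + 1
      (∃ m : ℤ, D * F * I = m ^ 2) ∧
      (∃ m : ℤ, (U ^ (2 * P.toNat) * V ^ 2 - 4) * K ^ 2 + 4 = m ^ 2) ∧
      ((p : ℤ) * A - (p : ℤ) ^ 2 - 1 ∣ ((p : ℤ) ^ 2 - 1) * W * C - (p : ℤ) * (W ^ 2 - 1)) ∧
      4 * (C - K * L) ^ 2 < K ^ 2) :
    (∃ n : ℕ, b = (p : ℤ) ^ n) ∧ Y ∣ ((P * X).toNat.choose (Q * X).toNat : ℤ) := by
  obtain ⟨h, k, l, w, x, y, hlx, hDFI, hKsq, hdvd, hlt⟩ := hexists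
  lift P to ℕ using by omega
  lift Q to ℕ using by omega
  lift X to ℕ using by omega
  rw [show (4 * (P : ℤ)).toNat = 4 * P by omega] at hYp
  simp only [Int.toNat_natCast] at hDFI hKsq hdvd hlt
  rw [← Nat.cast_mul, ← Nat.cast_mul, Int.toNat_natCast, Int.toNat_natCast]
  refine prime_pow_and_dvd_choose_of_lucasU hp (by omega) (by omega) hb hg hX hYb hYp
    (left_ne_zero_of_mul hlx) rfl rfl rfl rfl
    rfl rfl (fun hB hAB => ?_) hKsq hdvd hlt
  exact eq_lucasU_of_isSquare hB hAB ⟨h, by ring⟩ (right_ne_zero_of_mul hlx) rfl rfl rfl rfl rfl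
    rfl hDFI
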